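/- (Hilbert–Schmidt bound on the kinetic pairing kernel.) Let ℓ, b, C₀ > 0 and N ∈ ℕ, and let w : ℝ³ → ℝ be weakly differentiable with 0 ≤ w ≤ 1, supp w ⊆ {|x| ≤ Nℓ}, w(x) ≤ C₀b/|x| and |∇w(x)| ≤ C₀b/|x|² for all x ≠ 0. Let u ∈ H¹(ℝ³;ℂ) ∩ L^∞(ℝ³;ℂ) and define k(x,y) := −N w(N(x−y)) u(x) u(y), and the kernel g(y₁,y₂) := ∫_{ℝ³} ∇_x k(y₁,x) · ∇_x conj(k)(y₂,x) dx. Then there exists a constant C, depending only on ℓ, b and C₀, such that ‖g‖_{L²(ℝ³×ℝ³)} ≤ C·‖u‖_{L^∞}²·‖u‖_{H¹}². -/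

import Mathlib

open MeasureTheory Filter Metric Real Topology Function
open scoped ENNReal

noncomputable section

abbrev R3 : Type := EuclideanSpace ℝ (Fin 3)

/-- The pair-excitation kernel `k(x,y) = −N w(N(x−y)) u(x) v(y)`. -/
def pairKernel (N : ℕ) (w : R3 → ℝ) (u v : R3 → ℂ) (x y : R3) : ℂ :=
  -(N : ℂ) * ((w ((N : ℝ) • (x - y)) : ℝ) : ℂ) * u x * v y

/-- The `W^{1,r}`-type data of a function: `L^r` norm of the function and its gradient. -/
def W1Norm (r : ℝ≥0∞) (u : R3 → ℂ) : ℝ≥0∞ :=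
  eLpNorm u r volume + eLpNorm (fun x => fderiv ℝ u x) r volume

/-- The `i`-th standard coordinate vector of `ℝ³`. -/
def e3 (i : Fin 3) : R3 := EuclideanSpace.single i 1

/-- Gradient (in the second argument) of the kernel
`k(x,y) = −N w(N(x−y)) u(x) u(y)`, as a vector of coordinates. -/
def gradSecond (N : ℕ) (w : R3 → ℝ) (u : R3 → ℂ) (y x : R3) (i : Fin 3) : ℂ :=
  fderiv ℝ (fun z => pairKernel N w u u y z) x (e3 i)

/-- The kinetic pairing kernel `g(y₁,y₂) = ∫ ∇_x k(y₁,x) · ∇_x conj(k)(y₂,x) dx`. -/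
def kineticKernel (N : ℕ) (w : R3 → ℝ) (u : R3 → ℂ) (y₁ y₂ : R3) : ℂ :=
  ∫ x : R3, ∑ i : Fin 3,
    gradSecond N w u y₁ x i * (starRingEnd ℂ) (gradSecond N w u y₂ x i)

/-- Cauchy–Schwarz for the lower Lebesgue integral. -/
theorem sq_lintegral_mul_le {α : Type*} [MeasurableSpace α] (μ : Measure α) {f g : α → ℝ≥0∞}
    (hf : AEMeasurable f μ) (hg : AEMeasurable g μ) :
    (∫⁻ x, f x * g x ∂μ) ^ 2 ≤ (∫⁻ x, f x ^ 2 ∂μ) * ∫⁻ x, g x ^ 2 ∂μ := by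
  have h := ENNReal.lintegral_mul_le_Lp_mul_Lq μ Real.HolderConjugate.two_two hf hg
  simp only [Pi.mul_apply, ENNReal.rpow_two] at h
  have hsq : ∀ a : ℝ≥0∞, (a ^ (1 / 2 : ℝ)) ^ 2 = a := fun a => by
    rw [← ENNReal.rpow_two, ← ENNReal.rpow_mul]; norm_num
  calc _ ≤ ((∫⁻ x, f x ^ 2 ∂μ) ^ (1 / 2 : ℝ) * (∫⁻ x, g x ^ 2 ∂μ) ^ (1 / 2 : ℝ)) ^ 2 := by gcongr
    _ = _ := by rw [mul_pow, hsq, hsq]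

theorem ENNReal.add_sq_le_two_mul (a b : ℝ≥0∞) : (a + b) ^ 2 ≤ 2 * (a ^ 2 + b ^ 2) := by
  have := ENNReal.rpow_add_le_mul_rpow_add_rpow a b (p := 2) (by norm_num)
  norm_num at this
  exact_mod_cast this

theorem lintegral_comp_smul_R3 {f : R3 → ℝ≥0∞} (hf : Measurable f) {c : ℝ} (hc : 0 < c) :
    ∫⁻ x, f (c • x) = ENNReal.ofReal (c ^ 3)⁻¹ * ∫⁻ x, f x := by
  have h := Measure.map_addHaar_smul (volume : Measure R3) hc.ne'
  rw [← lintegral_map hf (measurable_const_smul c), h, lintegral_smul_measure]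
  simp [abs_of_pos hc]

theorem lintegral_inv_norm_sq_closedBall_ne_top (r : ℝ) :
    ∫⁻ z in closedBall (0 : R3) r, ‖z‖ₑ⁻¹ ^ 2 ≠ ∞ := by
  have h : IntegrableOn (fun x : R3 => (fun t : ℝ => (t ^ 2)⁻¹) ‖x‖) (ball (0 : R3) (r + 1)) := by
    refine (integrableOn_fun_norm_addHaar volume (f := fun t : ℝ => (t ^ 2)⁻¹)).2 ?_
    refine IntegrableOn.congr_fun (f := fun _ => (1 : ℝ)) ?_ ?_ measurableSet_Ioo
    · simp
    · intro y hy
      have : y ≠ 0 := hy.1.ne'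
      simp [this]
  have h2 := h.2
  refine ((lintegral_mono_set (closedBall_subset_ball (lt_add_one r))).trans_lt ?_).ne
  refine lt_of_le_of_lt (le_of_eq ?_) h2
  refine lintegral_congr_ae ?_
  filter_upwards [Measure.ae_ne _ (0 : R3)] with x hx
  have hx' : ‖x‖ ≠ 0 := by simpa using hx
  rw [enorm_inv (by positivity), enorm_pow, enorm_norm, ENNReal.inv_pow]

theorem lintegral_inv_norm_sq_mul_ne_top :
    ∫⁻ z : R3, ‖z‖ₑ⁻¹ ^ 2 * (max ‖z‖ₑ 2⁻¹)⁻¹ ^ 2 ≠ ∞ := by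
  rw [← lintegral_add_compl _ (measurableSet_closedBall (x := (0 : R3)) (ε := 1))]
  refine (ENNReal.add_lt_top.2 ⟨?_, ?_⟩).ne
  · calc _ ≤ ∫⁻ z in closedBall (0 : R3) 1, 4 * ‖z‖ₑ⁻¹ ^ 2 := by
          refine lintegral_mono fun z => ?_
          rw [mul_comm]
          gcongr
          calc (max ‖z‖ₑ 2⁻¹)⁻¹ ^ 2 ≤ (2⁻¹ : ℝ≥0∞)⁻¹ ^ 2 := by
                gcongr; exact le_max_right _ _
            _ = 4 := by norm_num
      _ < ∞ := by
          rw [lintegral_const_mul _ (by fun_prop)]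
          exact ENNReal.mul_lt_top (by simp) (lintegral_inv_norm_sq_closedBall_ne_top 1).lt_top
  · have h4 : ∫⁻ x : R3, ENNReal.ofReal ((1 + ‖x‖) ^ (-(4 : ℝ))) < ∞ :=
      finite_integral_one_add_norm (by simp; norm_num)
    refine lt_of_le_of_lt (b := ∫⁻ z in (closedBall (0 : R3) 1)ᶜ,
      16 * ENNReal.ofReal ((1 + ‖z‖) ^ (-(4 : ℝ)))) ?_ ?_
    · refine setLIntegral_mono' measurableSet_closedBall.compl fun z hz => ?_
      have hz1 : 1 < ‖z‖ := by simpa using hz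
      calc ‖z‖ₑ⁻¹ ^ 2 * (max ‖z‖ₑ 2⁻¹)⁻¹ ^ 2 ≤ ‖z‖ₑ⁻¹ ^ 2 * ‖z‖ₑ⁻¹ ^ 2 := by
            gcongr; exact le_max_left _ _
        _ = ENNReal.ofReal ((‖z‖ ^ 4)⁻¹) := by
            rw [← ofReal_norm, ← ENNReal.ofReal_inv_of_pos (by linarith),
              ← ENNReal.ofReal_pow (by positivity), ← ENNReal.ofReal_mul (by positivity)]
            congr 1; field_simp
        _ ≤ ENNReal.ofReal (16 * (1 + ‖z‖) ^ (-(4 : ℝ))) := by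
            apply ENNReal.ofReal_le_ofReal
            rw [Real.rpow_neg (by positivity)]
            have e : (1 + ‖z‖) ^ (4 : ℝ) = (1 + ‖z‖) ^ 4 := by exact_mod_cast Real.rpow_natCast _ 4
            rw [e, inv_eq_one_div, ← div_eq_mul_inv, div_le_div_iff₀ (by positivity) (by positivity)]
            have : (1 + ‖z‖) ^ 4 ≤ (2 * ‖z‖) ^ 4 := by gcongr; linarith
            linarith [mul_pow 2 ‖z‖ 4]
        _ = _ := by rw [ENNReal.ofReal_mul (by norm_num)]; norm_num
    · rw [lintegral_const_mul _ (by fun_prop)]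
      exact ENNReal.mul_lt_top (by simp) ((setLIntegral_le_lintegral _ _).trans_lt h4)

/-- The convolution of `|·|⁻²` with itself is bounded by a multiple of `|·|⁻¹`. -/
theorem exists_lintegral_inv_norm_sq_mul_inv_norm_sq_le :
    ∃ C : ℝ≥0∞, C ≠ ∞ ∧ ∀ y₁ y₂ : R3,
      ∫⁻ x, ‖y₁ - x‖ₑ⁻¹ ^ 2 * ‖y₂ - x‖ₑ⁻¹ ^ 2 ≤ C * ‖y₁ - y₂‖ₑ⁻¹ := by
  set I := ∫⁻ z : R3, ‖z‖ₑ⁻¹ ^ 2 * (max ‖z‖ₑ 2⁻¹)⁻¹ ^ 2 with hI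
  refine ⟨2 * I + 1, by simp [ENNReal.mul_eq_top, lintegral_inv_norm_sq_mul_ne_top, hI],
    fun y₁ y₂ => ?_⟩
  rcases eq_or_ne y₁ y₂ with rfl | hne
  · simp
  set d := ‖y₁ - y₂‖ with hd
  have hd0 : 0 < d := by rw [hd]; simpa [sub_eq_zero] using hne
  set D := ‖y₁ - y₂‖ₑ with hD
  have hDd : D = ENNReal.ofReal d := (ofReal_norm _).symm
  have hD0 : D ≠ 0 := by simp [hDd, hd0]
  have hDt : D ≠ ∞ := by simp [hDd]
  let H : R3 → ℝ≥0∞ := fun z => ‖z‖ₑ⁻¹ ^ 2 * (max ‖z‖ₑ (D * 2⁻¹))⁻¹ ^ 2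
  have hHm : Measurable H := by fun_prop
  have hHint : ∫⁻ z, H z = I * D⁻¹ := by
    have h1 := lintegral_comp_smul_R3 hHm hd0
    have h2 : ∀ z : R3, H (d • z) = D⁻¹ ^ 4 * (‖z‖ₑ⁻¹ ^ 2 * (max ‖z‖ₑ 2⁻¹)⁻¹ ^ 2) := fun z => by
      have e : ‖d • z‖ₑ = D * ‖z‖ₑ := by
        rw [enorm_smul, hDd, Real.enorm_of_nonneg hd0.le]
      have em : max (D * ‖z‖ₑ) (D * 2⁻¹) = D * max ‖z‖ₑ 2⁻¹ := (mul_max_of_nonneg _ _ (by simp)).symm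
      simp only [H, e, em]
      rw [ENNReal.mul_inv (by simp [hD0]) (by simp [hDt]),
        ENNReal.mul_inv (by simp [hD0]) (by simp [hDt])]
      ring
    simp_rw [h2] at h1
    rw [lintegral_const_mul _ (by fun_prop), ← hI] at h1
    have h3 : ENNReal.ofReal (d ^ 3)⁻¹ = D⁻¹ ^ 3 := by
      rw [ENNReal.ofReal_inv_of_pos (by positivity), ENNReal.ofReal_pow hd0.le, hDd,
        ENNReal.inv_pow]
    rw [h3] at h1
    have h4 : D ^ 3 * D⁻¹ ^ 3 = 1 := by rw [← mul_pow, ENNReal.mul_inv_cancel hD0 hDt, one_pow]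
    calc ∫⁻ z, H z = (D ^ 3 * D⁻¹ ^ 3) * ∫⁻ z, H z := by rw [h4, one_mul]
      _ = (D ^ 3 * D⁻¹ ^ 3) * (I * D⁻¹) := by rw [mul_assoc, ← h1]; ring
      _ = _ := by rw [h4, one_mul]
  have key : ∀ a b : R3, ‖a‖ₑ ≤ ‖b‖ₑ → D ≤ ‖a‖ₑ + ‖b‖ₑ →
      ‖a‖ₑ⁻¹ ^ 2 * ‖b‖ₑ⁻¹ ^ 2 ≤ H a := fun a b hab hDab => by
    simp only [H]
    gcongr
    refine max_le hab ?_
    rw [← div_eq_mul_inv]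
    refine ENNReal.div_le_of_le_mul (hDab.trans ?_)
    rw [mul_two]; gcongr
  have hDle : ∀ x, D ≤ ‖y₁ - x‖ₑ + ‖y₂ - x‖ₑ := fun x => by
    have : y₁ - y₂ = (y₁ - x) - (y₂ - x) := by abel
    rw [hD, this]; exact enorm_sub_le
  calc ∫⁻ x, ‖y₁ - x‖ₑ⁻¹ ^ 2 * ‖y₂ - x‖ₑ⁻¹ ^ 2 ≤ ∫⁻ x, (H (y₁ - x) + H (y₂ - x)) := by
        refine lintegral_mono fun x => ?_
        rcases le_total ‖y₁ - x‖ₑ ‖y₂ - x‖ₑ with h | h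
        · exact (key _ _ h (hDle x)).trans le_self_add
        · rw [mul_comm]
          exact (key _ _ h (by rw [add_comm]; exact hDle x)).trans le_add_self
    _ = 2 * I * D⁻¹ := by
        rw [lintegral_add_left (by fun_prop), lintegral_sub_left_eq_self H,
          lintegral_sub_left_eq_self H, hHint]
        ring
    _ ≤ (2 * I + 1) * D⁻¹ := by gcongr; exact le_self_add

theorem enorm_sub_le_lintegral_Icc {f f' : ℝ → ℂ} {a b : ℝ} (hab : a ≤ b)
    (hf : ∀ s, HasDerivAt f (f' s) s) :
    ‖f b - f a‖ₑ ≤ ∫⁻ s in Set.Icc a b, ‖f' s‖ₑ := by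
  by_cases hfin : ∫⁻ s in Set.Icc a b, ‖f' s‖ₑ = ∞
  · simp [hfin]
  have hm : Measurable f' := by
    rw [show f' = deriv f from funext fun s => (hf s).deriv.symm]
    exact measurable_deriv f
  have hint : IntegrableOn f' (Set.Icc a b) := ⟨hm.aestronglyMeasurable, lt_top_iff_ne_top.2 hfin⟩
  have hii : IntervalIntegrable f' volume a b :=
    (intervalIntegrable_iff_integrableOn_Icc_of_le hab).2 hint
  rw [← intervalIntegral.integral_eq_sub_of_hasDerivAt (fun s _ => hf s) hii,
    intervalIntegral.integral_of_le hab, ← integral_Icc_eq_integral_Ioc]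
  exact enorm_integral_le_lintegral_enorm _

/-- Hardy's inequality for bounded, everywhere differentiable functions in `L²(ℝ³)`. -/
theorem lintegral_enorm_sq_mul_inv_norm_sq_le {v : R3 → ℂ} (hv : Differentiable ℝ v)
    {M : ℝ≥0∞} (hM : M ≠ ∞) (hvM : ∀ x, ‖v x‖ₑ ≤ M) (hv2 : ∫⁻ x, ‖v x‖ₑ ^ 2 ≠ ∞) :
    ∫⁻ x, ‖v x‖ₑ ^ 2 * ‖x‖ₑ⁻¹ ^ 2 ≤ 36 * ∫⁻ x, ‖fderiv ℝ v x‖ₑ ^ 2 := by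
  have hvm : Measurable v := hv.continuous.measurable
  have hdm : Measurable (fderiv ℝ v) := measurable_fderiv ℝ v
  set Q := ∫⁻ x, ‖v x‖ₑ ^ 2 * ‖x‖ₑ⁻¹ ^ 2 with hQ
  set D := ∫⁻ x, ‖fderiv ℝ v x‖ₑ ^ 2
  have hQfin : Q ≠ ∞ := by
    rw [hQ, ← lintegral_add_compl _ (measurableSet_closedBall (x := (0 : R3)) (ε := 1))]
    refine (ENNReal.add_lt_top.2 ⟨?_, ?_⟩).ne
    · calc _ ≤ ∫⁻ z in closedBall (0 : R3) 1, M ^ 2 * ‖z‖ₑ⁻¹ ^ 2 := by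
            refine lintegral_mono fun z => ?_
            gcongr
            exact hvM z
        _ < ∞ := by
            rw [lintegral_const_mul _ (by fun_prop)]
            exact ENNReal.mul_lt_top (by simp [hM.lt_top])
              (lintegral_inv_norm_sq_closedBall_ne_top 1).lt_top
    · refine lt_of_le_of_lt ?_ hv2.lt_top
      refine (setLIntegral_mono' measurableSet_closedBall.compl fun z hz => ?_).trans
        (setLIntegral_le_lintegral _ _)
      have hz1 : 1 < ‖z‖ := by simpa using hz
      have : ‖z‖ₑ⁻¹ ≤ 1 := by
        rw [ENNReal.inv_le_one, ← ofReal_norm]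
        exact ENNReal.one_le_ofReal.2 hz1.le
      calc _ ≤ ‖v z‖ₑ ^ 2 * 1 ^ 2 := by gcongr
        _ = _ := by simp
  have hpt : ∀ x, ‖v x‖ₑ ^ 2 * ‖x‖ₑ⁻¹ ^ 2 ≤ 2 * (‖v ((4 : ℝ) • x)‖ₑ ^ 2 * ‖x‖ₑ⁻¹ ^ 2) +
      6 * ∫⁻ s in Set.Icc (1 : ℝ) 4, ‖fderiv ℝ v (s • x)‖ₑ ^ 2 := fun x => by
    have hm1 : Measurable fun s : ℝ => ‖fderiv ℝ v (s • x)‖ₑ :=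
      (hdm.comp (by fun_prop : Measurable fun s : ℝ => s • x)).enorm
    have h1 : ‖v ((4 : ℝ) • x) - v ((1 : ℝ) • x)‖ₑ ≤
        ∫⁻ s in Set.Icc (1 : ℝ) 4, ‖fderiv ℝ v (s • x) x‖ₑ :=
      enorm_sub_le_lintegral_Icc (f := fun s : ℝ => v (s • x)) (by norm_num) fun s => by
        have := (hv (s • x)).hasFDerivAt.comp_hasDerivAt s ((hasDerivAt_id s).smul_const x)
        rwa [one_smul] at this
    have h2 : ∫⁻ s in Set.Icc (1 : ℝ) 4, ‖fderiv ℝ v (s • x) x‖ₑ ≤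
        (∫⁻ s in Set.Icc (1 : ℝ) 4, ‖fderiv ℝ v (s • x)‖ₑ) * ‖x‖ₑ := by
      rw [← lintegral_mul_const _ hm1]
      exact lintegral_mono fun s => ContinuousLinearMap.le_opENorm _ _
    have h3 : (∫⁻ s in Set.Icc (1 : ℝ) 4, ‖fderiv ℝ v (s • x)‖ₑ) ^ 2 ≤
        3 * ∫⁻ s in Set.Icc (1 : ℝ) 4, ‖fderiv ℝ v (s • x)‖ₑ ^ 2 := by
      have := sq_lintegral_mul_le (volume.restrict (Set.Icc (1 : ℝ) 4)) (f := fun _ => 1)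
        aemeasurable_const hm1.aemeasurable
      simp only [one_mul, one_pow, lintegral_const, Measure.restrict_apply_univ,
        Real.volume_Icc] at this
      norm_num at this
      exact this
    set J := ∫⁻ s in Set.Icc (1 : ℝ) 4, ‖fderiv ℝ v (s • x)‖ₑ
    have h4 : ‖v x‖ₑ ≤ ‖v ((4 : ℝ) • x)‖ₑ + J * ‖x‖ₑ := by
      have e : v x = v ((4 : ℝ) • x) - (v ((4 : ℝ) • x) - v ((1 : ℝ) • x)) := by simp
      rw [e]
      refine enorm_sub_le.trans ?_
      simp only [one_smul] at h1 ⊢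
      gcongr
      exact h1.trans h2
    calc ‖v x‖ₑ ^ 2 * ‖x‖ₑ⁻¹ ^ 2
        ≤ (2 * (‖v ((4 : ℝ) • x)‖ₑ ^ 2 + (J * ‖x‖ₑ) ^ 2)) * ‖x‖ₑ⁻¹ ^ 2 := by
          gcongr
          exact (by gcongr : ‖v x‖ₑ ^ 2 ≤ (‖v ((4 : ℝ) • x)‖ₑ + J * ‖x‖ₑ) ^ 2).trans
            (ENNReal.add_sq_le_two_mul _ _)
      _ = 2 * (‖v ((4 : ℝ) • x)‖ₑ ^ 2 * ‖x‖ₑ⁻¹ ^ 2) + 2 * J ^ 2 * (‖x‖ₑ * ‖x‖ₑ⁻¹) ^ 2 := by ring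
      _ ≤ 2 * (‖v ((4 : ℝ) • x)‖ₑ ^ 2 * ‖x‖ₑ⁻¹ ^ 2) + 2 * (3 *
          ∫⁻ s in Set.Icc (1 : ℝ) 4, ‖fderiv ℝ v (s • x)‖ₑ ^ 2) * 1 ^ 2 := by
          gcongr
          exact ENNReal.mul_inv_le_one _
      _ = _ := by ring
  have hscale : ∫⁻ x : R3, ‖v ((4 : ℝ) • x)‖ₑ ^ 2 * ‖x‖ₑ⁻¹ ^ 2 = 4⁻¹ * Q := by
    have h1 := lintegral_comp_smul_R3
      (f := fun x => ‖v x‖ₑ ^ 2 * ‖x‖ₑ⁻¹ ^ 2) (by fun_prop) (c := 4) (by norm_num)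
    have h2 : ∀ x : R3, ‖v ((4 : ℝ) • x)‖ₑ ^ 2 * ‖x‖ₑ⁻¹ ^ 2 =
        16 * (‖v ((4 : ℝ) • x)‖ₑ ^ 2 * ‖(4 : ℝ) • x‖ₑ⁻¹ ^ 2) := fun x => by
      have e4 : ‖(4 : ℝ)‖ₑ = 4 := by
        rw [Real.enorm_of_nonneg (by norm_num)]; norm_num
      rw [enorm_smul, e4, ENNReal.mul_inv (by simp) (by simp), mul_pow]
      have : (16 : ℝ≥0∞) * 4⁻¹ ^ 2 = 1 := by
        rw [← ENNReal.inv_pow, show (4 : ℝ≥0∞) ^ 2 = 16 by norm_num]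
        exact ENNReal.mul_inv_cancel (by simp) (by simp)
      calc _ = ‖v ((4 : ℝ) • x)‖ₑ ^ 2 * ‖x‖ₑ⁻¹ ^ 2 * (16 * 4⁻¹ ^ 2) := by rw [this, mul_one]
        _ = _ := by ring
    simp_rw [h2]
    rw [lintegral_const_mul _ (by fun_prop), h1, ← hQ, ← mul_assoc]
    congr 1
    rw [show (16 : ℝ≥0∞) = ENNReal.ofReal 16 by norm_num, ← ENNReal.ofReal_mul (by norm_num),
      show (4⁻¹ : ℝ≥0∞) = ENNReal.ofReal 4⁻¹ by
        rw [ENNReal.ofReal_inv_of_pos (by norm_num)]; norm_num]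
    norm_num
  have hjm : Measurable (uncurry fun (x : R3) (s : ℝ) => ‖fderiv ℝ v (s • x)‖ₑ ^ 2) :=
    ((hdm.comp (by fun_prop : Measurable fun p : R3 × ℝ => p.2 • p.1)).enorm).pow_const 2
  have hgrad : ∫⁻ x : R3, ∫⁻ s in Set.Icc (1 : ℝ) 4, ‖fderiv ℝ v (s • x)‖ₑ ^ 2 ≤ 3 * D := by
    rw [lintegral_lintegral_swap hjm.aemeasurable]
    calc _ ≤ ∫⁻ s in Set.Icc (1 : ℝ) 4, D := by
          refine setLIntegral_mono' measurableSet_Icc fun s hs => ?_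
          rw [lintegral_comp_smul_R3 (f := fun x => ‖fderiv ℝ v x‖ₑ ^ 2)
            (hdm.enorm.pow_const 2) (by linarith [hs.1])]
          have : ENNReal.ofReal (s ^ 3)⁻¹ ≤ 1 := by
            rw [ENNReal.ofReal_le_one]
            exact inv_le_one_of_one_le₀ (one_le_pow₀ hs.1)
          calc _ ≤ 1 * D := by gcongr
            _ = D := one_mul _
      _ = 3 * D := by
          rw [setLIntegral_const, Real.volume_Icc]; norm_num; ring
  have hmain : Q ≤ 2⁻¹ * Q + 18 * D := by
    calc Q ≤ ∫⁻ x, (2 * (‖v ((4 : ℝ) • x)‖ₑ ^ 2 * ‖x‖ₑ⁻¹ ^ 2) +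
          6 * ∫⁻ s in Set.Icc (1 : ℝ) 4, ‖fderiv ℝ v (s • x)‖ₑ ^ 2) := lintegral_mono hpt
      _ = 2 * (4⁻¹ * Q) +
          6 * ∫⁻ x, ∫⁻ s in Set.Icc (1 : ℝ) 4, ‖fderiv ℝ v (s • x)‖ₑ ^ 2 := by
          rw [lintegral_add_left (by fun_prop), lintegral_const_mul _ (by fun_prop), hscale,
            lintegral_const_mul _ (Measurable.lintegral_prod_right hjm)]
      _ ≤ 2 * (4⁻¹ * Q) + 6 * (3 * D) := by gcongr
      _ = 2⁻¹ * Q + 18 * D := by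
          rw [← mul_assoc, ← mul_assoc, show (4 : ℝ≥0∞) = 2 * 2 by norm_num,
            ENNReal.mul_inv (by simp) (by simp), ← mul_assoc,
            ENNReal.mul_inv_cancel (by simp) (by simp), one_mul]
          norm_num
  have hhalf : 2⁻¹ * Q ≤ 18 * D := by
    have hQ2 : 2⁻¹ * Q + 2⁻¹ * Q = Q := by rw [← add_mul, ENNReal.inv_two_add_inv_two, one_mul]
    refine (ENNReal.add_le_add_iff_left (a := 2⁻¹ * Q) (ENNReal.mul_ne_top (by simp) hQfin)).1 ?_
    rw [hQ2]; exact hmain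
  calc Q = 2 * (2⁻¹ * Q) := by
        rw [← mul_assoc, ENNReal.mul_inv_cancel (by simp) (by simp), one_mul]
    _ ≤ 2 * (18 * D) := by gcongr
    _ = 36 * D := by rw [← mul_assoc]; norm_num

theorem lintegral_prod_mul_sq_le {φ ψ β : R3 → ℝ≥0∞} (hφ : Measurable φ) (hψ : Measurable ψ)
    (hβ : Measurable β) {M K I C h : ℝ≥0∞} (hφM : ∀ x, φ x ≤ M)
    (hφ2 : ∫⁻ x, φ x ^ 2 ≤ K ^ 2) (hψ2 : ∫⁻ x, ψ x ^ 2 ≤ K ^ 2)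
    (hβr : ∀ z, β z ≤ ‖z‖ₑ⁻¹) (hβI : ∫⁻ z, β z ^ 2 ≤ I)
    (hC : ∀ y₁ y₂ : R3, ∫⁻ x, ‖y₁ - x‖ₑ⁻¹ ^ 2 * ‖y₂ - x‖ₑ⁻¹ ^ 2 ≤ C * ‖y₁ - y₂‖ₑ⁻¹)
    (hH : ∀ y : R3, ∫⁻ x, ‖y - x‖ₑ⁻¹ ^ 2 * φ x ^ 2 ≤ h * K ^ 2) :
    ∫⁻ z : R3 × R3, (∫⁻ x, (φ z.1 * (β (z.1 - x) ^ 2 * φ x + β (z.1 - x) * ψ x)) *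
      (φ z.2 * (β (z.2 - x) ^ 2 * φ x + β (z.2 - x) * ψ x))) ^ 2 ≤
      4 * (C ^ 2 * h + 2 * h * I ^ 2 + I ^ 2) * M ^ 4 * K ^ 4 := by
  let P : R3 → ℝ≥0∞ := fun y => ∫⁻ x, β (y - x) ^ 2 * ψ x ^ 2
  let S : R3 → R3 → ℝ≥0∞ := fun y₁ y₂ => ∫⁻ x, β (y₁ - x) ^ 2 * β (y₂ - x) ^ 2 * ψ x ^ 2
  have hβint : ∀ x : R3, ∫⁻ y, β (y - x) ^ 2 ≤ I := fun x => by
    rw [lintegral_sub_right_eq_self fun z => β z ^ 2]; exact hβI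
  have hPm : Measurable P :=
    Measurable.lintegral_prod_right (f := fun y x => β (y - x) ^ 2 * ψ x ^ 2) (by fun_prop)
  have hSm : Measurable fun z : R3 × R3 => S z.1 z.2 :=
    Measurable.lintegral_prod_right
      (f := fun (z : R3 × R3) x => β (z.1 - x) ^ 2 * β (z.2 - x) ^ 2 * ψ x ^ 2) (by fun_prop)
  have hPint : ∫⁻ y, P y ≤ I * K ^ 2 := by
    rw [lintegral_lintegral_swap (by fun_prop)]
    calc _ = ∫⁻ x, (∫⁻ y, β (y - x) ^ 2) * ψ x ^ 2 :=
          lintegral_congr fun x => lintegral_mul_const _ (by fun_prop)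
      _ ≤ ∫⁻ x, I * ψ x ^ 2 := lintegral_mono fun x => by gcongr; exact hβint x
      _ ≤ I * K ^ 2 := by
          rw [lintegral_const_mul _ (by fun_prop)]; gcongr
  have hSint : ∫⁻ y₁, ∫⁻ y₂, S y₁ y₂ ≤ I ^ 2 * K ^ 2 := by
    have hS1 : ∀ y₁, ∫⁻ y₂, S y₁ y₂ ≤ I * P y₁ := fun y₁ => by
      rw [lintegral_lintegral_swap (by fun_prop)]
      calc _ = ∫⁻ x, (∫⁻ y₂, β (y₂ - x) ^ 2) * (β (y₁ - x) ^ 2 * ψ x ^ 2) := by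
            refine lintegral_congr fun x => ?_
            rw [← lintegral_mul_const _ (by fun_prop)]
            exact lintegral_congr fun y => by ring
        _ ≤ ∫⁻ x, I * (β (y₁ - x) ^ 2 * ψ x ^ 2) := lintegral_mono fun x => by
            gcongr; exact hβint x
        _ = I * P y₁ := lintegral_const_mul _ (by fun_prop)
    calc _ ≤ ∫⁻ y₁, I * P y₁ := lintegral_mono hS1
      _ = I * ∫⁻ y₁, P y₁ := lintegral_const_mul _ hPm
      _ ≤ I * (I * K ^ 2) := by gcongr
      _ = _ := by ring
  have hpt : ∀ y₁ y₂ : R3,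
      (∫⁻ x, (φ y₁ * (β (y₁ - x) ^ 2 * φ x + β (y₁ - x) * ψ x)) *
        (φ y₂ * (β (y₂ - x) ^ 2 * φ x + β (y₂ - x) * ψ x))) ^ 2 ≤
      (4 * C ^ 2 * M ^ 4) * (φ y₁ ^ 2 * (‖y₁ - y₂‖ₑ⁻¹ ^ 2 * φ y₂ ^ 2)) +
      (8 * h * M ^ 4 * K ^ 2) * S y₁ y₂ + (4 * M ^ 4) * (P y₁ * P y₂) := fun y₁ y₂ => by
    let T₁ := ∫⁻ x, β (y₁ - x) ^ 2 * β (y₂ - x) ^ 2 * φ x ^ 2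
    let U : R3 → R3 → ℝ≥0∞ := fun y y' => ∫⁻ x, (β (y - x) * φ x) * (β (y - x) * β (y' - x) * ψ x)
    let T₄ := ∫⁻ x, (β (y₁ - x) * ψ x) * (β (y₂ - x) * ψ x)
    have hsplit : ∫⁻ x, (φ y₁ * (β (y₁ - x) ^ 2 * φ x + β (y₁ - x) * ψ x)) *
        (φ y₂ * (β (y₂ - x) ^ 2 * φ x + β (y₂ - x) * ψ x)) =
        φ y₁ * φ y₂ * ((T₁ + U y₁ y₂) + (U y₂ y₁ + T₄)) := by
      simp only [T₁, U, T₄]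
      rw [← lintegral_add_left (by fun_prop), ← lintegral_add_left (by fun_prop),
        ← lintegral_add_left (by fun_prop), ← lintegral_const_mul _ (by fun_prop)]
      exact lintegral_congr fun x => by ring
    have hT₁ : T₁ ≤ M ^ 2 * (C * ‖y₁ - y₂‖ₑ⁻¹) := by
      calc T₁ ≤ ∫⁻ x, M ^ 2 * (‖y₁ - x‖ₑ⁻¹ ^ 2 * ‖y₂ - x‖ₑ⁻¹ ^ 2) := by
            refine lintegral_mono fun x => ?_
            simp only
            rw [mul_comm]
            gcongr
            exacts [hφM x, hβr _, hβr _]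
        _ ≤ _ := by
            rw [lintegral_const_mul _ (by fun_prop)]
            gcongr
            exact hC y₁ y₂
    have hU : ∀ y y', U y y' ^ 2 ≤ (h * K ^ 2) * S y y' := fun y y' => by
      refine (sq_lintegral_mul_le _ (by fun_prop) (by fun_prop)).trans ?_
      simp only [mul_pow, S]
      gcongr
      refine (lintegral_mono fun x => ?_).trans (hH y)
      gcongr
      exact hβr _
    have hSsymm : S y₂ y₁ = S y₁ y₂ := lintegral_congr fun x => by ring
    have hT₄ : T₄ ^ 2 ≤ P y₁ * P y₂ := by
      refine (sq_lintegral_mul_le _ (by fun_prop) (by fun_prop)).trans ?_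
      simp only [mul_pow, P]
      exact le_rfl
    rw [hsplit, mul_pow]
    have hsum : ((T₁ + U y₁ y₂) + (U y₂ y₁ + T₄)) ^ 2 ≤
        4 * (T₁ ^ 2 + U y₁ y₂ ^ 2 + U y₂ y₁ ^ 2 + T₄ ^ 2) := by
      calc _ ≤ 2 * ((T₁ + U y₁ y₂) ^ 2 + (U y₂ y₁ + T₄) ^ 2) := ENNReal.add_sq_le_two_mul _ _
        _ ≤ 2 * (2 * (T₁ ^ 2 + U y₁ y₂ ^ 2) + 2 * (U y₂ y₁ ^ 2 + T₄ ^ 2)) := by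
            gcongr <;> exact ENNReal.add_sq_le_two_mul _ _
        _ = _ := by ring
    have hU' := hU y₂ y₁
    rw [hSsymm] at hU'
    calc _ ≤ (φ y₁ * φ y₂) ^ 2 * (4 * ((M ^ 2 * (C * ‖y₁ - y₂‖ₑ⁻¹)) ^ 2 +
          (h * K ^ 2) * S y₁ y₂ + (h * K ^ 2) * S y₁ y₂ + P y₁ * P y₂)) := by
          gcongr
          refine hsum.trans ?_
          gcongr
          exact hU y₁ y₂
      _ = (4 * C ^ 2 * M ^ 4) * (φ y₁ ^ 2 * (‖y₁ - y₂‖ₑ⁻¹ ^ 2 * φ y₂ ^ 2)) +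
          (φ y₁ * φ y₂) ^ 2 * (8 * h * K ^ 2 * S y₁ y₂ + 4 * (P y₁ * P y₂)) := by ring
      _ ≤ (4 * C ^ 2 * M ^ 4) * (φ y₁ ^ 2 * (‖y₁ - y₂‖ₑ⁻¹ ^ 2 * φ y₂ ^ 2)) +
          (M * M) ^ 2 * (8 * h * K ^ 2 * S y₁ y₂ + 4 * (P y₁ * P y₂)) := by
          gcongr <;> exact hφM _
      _ = _ := by ring
  have hA : ∫⁻ z : R3 × R3, φ z.1 ^ 2 * (‖z.1 - z.2‖ₑ⁻¹ ^ 2 * φ z.2 ^ 2) ≤ h * K ^ 4 := by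
    rw [Measure.volume_eq_prod, lintegral_prod _ (by fun_prop)]
    calc _ = ∫⁻ y, φ y ^ 2 * ∫⁻ x, ‖y - x‖ₑ⁻¹ ^ 2 * φ x ^ 2 :=
          lintegral_congr fun y => lintegral_const_mul _ (by fun_prop)
      _ ≤ ∫⁻ y, φ y ^ 2 * (h * K ^ 2) := lintegral_mono fun y => by gcongr; exact hH y
      _ ≤ K ^ 2 * (h * K ^ 2) := by
          rw [lintegral_mul_const _ (by fun_prop)]; gcongr
      _ = _ := by ring
  have hB : ∫⁻ z : R3 × R3, S z.1 z.2 ≤ I ^ 2 * K ^ 2 := by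
    rw [Measure.volume_eq_prod, lintegral_prod _ hSm.aemeasurable]
    exact hSint
  have hD : ∫⁻ z : R3 × R3, P z.1 * P z.2 ≤ (I * K ^ 2) ^ 2 := by
    rw [Measure.volume_eq_prod, lintegral_prod_mul hPm.aemeasurable hPm.aemeasurable, sq]
    gcongr
  calc _ ≤ ∫⁻ z : R3 × R3, ((4 * C ^ 2 * M ^ 4) *
        (φ z.1 ^ 2 * (‖z.1 - z.2‖ₑ⁻¹ ^ 2 * φ z.2 ^ 2)) +
        (8 * h * M ^ 4 * K ^ 2) * S z.1 z.2 + (4 * M ^ 4) * (P z.1 * P z.2)) :=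
        lintegral_mono fun z => hpt z.1 z.2
    _ ≤ (4 * C ^ 2 * M ^ 4) * (h * K ^ 4) + (8 * h * M ^ 4 * K ^ 2) * (I ^ 2 * K ^ 2) +
        (4 * M ^ 4) * (I * K ^ 2) ^ 2 := by
        rw [lintegral_add_left (by fun_prop), lintegral_add_left (by fun_prop),
          lintegral_const_mul _ (by fun_prop), lintegral_const_mul _ (by fun_prop),
          lintegral_const_mul _ (by fun_prop)]
        gcongr
    _ = _ := by ring

/-- The truncated inverse norm `1_{|z| ≤ ℓ} |z|⁻¹`. -/
def cutInvNorm (ℓ : ℝ) : R3 → ℝ≥0∞ := (closedBall (0 : R3) ℓ).indicator fun z => ‖z‖ₑ⁻¹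

theorem measurable_cutInvNorm (ℓ : ℝ) : Measurable (cutInvNorm ℓ) :=
  (by fun_prop : Measurable fun z : R3 => ‖z‖ₑ⁻¹).indicator measurableSet_closedBall

theorem cutInvNorm_le (ℓ : ℝ) (z : R3) : cutInvNorm ℓ z ≤ ‖z‖ₑ⁻¹ :=
  Set.indicator_le_self' (fun _ _ => zero_le) z

theorem lintegral_cutInvNorm_sq (ℓ : ℝ) :
    ∫⁻ z, cutInvNorm ℓ z ^ 2 = ∫⁻ z in closedBall (0 : R3) ℓ, ‖z‖ₑ⁻¹ ^ 2 := by
  rw [← lintegral_indicator measurableSet_closedBall]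
  refine lintegral_congr fun z => ?_
  by_cases hz : z ∈ closedBall (0 : R3) ℓ <;> simp [cutInvNorm, hz]

theorem norm_fderiv_pairKernel_le {N : ℕ} (hN : N ≠ 0) {w : R3 → ℝ} {u : R3 → ℂ} {y x : R3}
    (hw : DifferentiableAt ℝ w ((N : ℝ) • (y - x))) (hu : DifferentiableAt ℝ u x) :
    ‖fderiv ℝ (fun z => pairKernel N w u u y z) x‖ ≤
      ‖u y‖ * ((N : ℝ) ^ 2 * ‖fderiv ℝ w ((N : ℝ) • (y - x))‖ * ‖u x‖ +
        N * |w ((N : ℝ) • (y - x))| * ‖fderiv ℝ u x‖) := by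
  have hlin : HasFDerivAt (fun z : R3 => (N : ℝ) • (y - z))
      ((N : ℝ) • (-ContinuousLinearMap.id ℝ R3)) x :=
    ((hasFDerivAt_id x).const_sub y).const_smul (N : ℝ)
  have hp := hw.hasFDerivAt.comp x hlin
  have h := (hp.smul hu.hasFDerivAt).const_mul (-(N : ℂ) * u y)
  have hfun : (fun z => pairKernel N w u u y z) = fun z =>
      (-(N : ℂ) * u y) * ((w ∘ fun z : R3 => (N : ℝ) • (y - z)) • u) z := by
    funext z
    simp only [pairKernel, Pi.smul_apply', Function.comp_apply, Complex.real_smul]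
    ring
  rw [hfun, h.fderiv, norm_smul]
  have hn : ‖-(N : ℂ) * u y‖ = N * ‖u y‖ := by simp
  rw [hn]
  have hcomp : ‖(fderiv ℝ w ((N : ℝ) • (y - x))).comp
      ((N : ℝ) • (-ContinuousLinearMap.id ℝ R3))‖ ≤ N * ‖fderiv ℝ w ((N : ℝ) • (y - x))‖ := by
    refine (ContinuousLinearMap.opNorm_comp_le _ _).trans ?_
    rw [norm_smul, norm_neg, mul_comm]
    gcongr
    simp
  refine (mul_le_mul_of_nonneg_left (norm_add_le _ _) (by positivity)).trans ?_
  rw [norm_smul, ContinuousLinearMap.norm_smulRight_apply, Real.norm_eq_abs]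
  simp only [Function.comp_apply]
  calc _ ≤ N * ‖u y‖ * (|w ((N : ℝ) • (y - x))| * ‖fderiv ℝ u x‖ +
        N * ‖fderiv ℝ w ((N : ℝ) • (y - x))‖ * ‖u x‖) := by gcongr
    _ = _ := by ring

theorem enorm_fderiv_pairKernel_le {ℓ c : ℝ} (hc : 0 ≤ c) {N : ℕ} {w : R3 → ℝ} {u : R3 → ℂ}
    (hw0 : ∀ x, 0 ≤ w x) (hsupp : Function.support w ⊆ closedBall (0 : R3) (N * ℓ))
    (hw1 : ∀ x : R3, x ≠ 0 → w x ≤ c / ‖x‖)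
    (hw2 : ∀ x : R3, x ≠ 0 → DifferentiableAt ℝ w x ∧ ‖fderiv ℝ w x‖ ≤ c / ‖x‖ ^ 2)
    (hu : Differentiable ℝ u) {y x : R3} (hxy : x ≠ y) :
    ‖fderiv ℝ (fun z => pairKernel N w u u y z) x‖ₑ ≤ ENNReal.ofReal c *
      (‖u y‖ₑ * (cutInvNorm ℓ (y - x) ^ 2 * ‖u x‖ₑ + cutInvNorm ℓ (y - x) * ‖fderiv ℝ u x‖ₑ)) := by
  rcases eq_or_ne N 0 with rfl | hN
  · have : fderiv ℝ (fun z => pairKernel 0 w u u y z) x = 0 := by simp [pairKernel]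
    rw [this, ← ofReal_norm]
    simp
  have hNpos : (0 : ℝ) < N := by positivity
  have hr : 0 < ‖y - x‖ := norm_pos_iff.2 (sub_ne_zero.2 hxy.symm)
  set z := (N : ℝ) • (y - x) with hz
  have hnz : ‖z‖ = N * ‖y - x‖ := by rw [hz, norm_smul, Real.norm_of_nonneg hNpos.le]
  have hz0 : z ≠ 0 := by rw [← norm_pos_iff, hnz]; positivity
  have hmain := norm_fderiv_pairKernel_le hN (u := u) (hw2 z hz0).1 (hu x)
  rw [← hz] at hmain
  by_cases hin : ‖y - x‖ ≤ ℓ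
  · have hcut : cutInvNorm ℓ (y - x) = ENNReal.ofReal ‖y - x‖⁻¹ := by
      rw [cutInvNorm, Set.indicator_of_mem (by simpa using hin), ← ofReal_norm,
        ENNReal.ofReal_inv_of_pos hr]
    rw [hcut, ← ofReal_norm, ← ofReal_norm, ← ofReal_norm, ← ofReal_norm,
      ← ENNReal.ofReal_pow (by positivity), ← ENNReal.ofReal_mul (by positivity),
      ← ENNReal.ofReal_mul (by positivity), ← ENNReal.ofReal_add (by positivity) (by positivity),
      ← ENNReal.ofReal_mul (by positivity), ← ENNReal.ofReal_mul hc]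
    refine ENNReal.ofReal_le_ofReal (hmain.trans ?_)
    have h1 : (N : ℝ) ^ 2 * ‖fderiv ℝ w z‖ ≤ c * ‖y - x‖⁻¹ ^ 2 := by
      calc _ ≤ (N : ℝ) ^ 2 * (c / ‖z‖ ^ 2) := by gcongr; exact (hw2 z hz0).2
        _ = _ := by rw [hnz]; field_simp
    have h2 : N * |w z| ≤ c * ‖y - x‖⁻¹ := by
      rw [abs_of_nonneg (hw0 z)]
      calc _ ≤ N * (c / ‖z‖) := by gcongr; exact hw1 z hz0
        _ = _ := by rw [hnz]; field_simp
    calc _ ≤ ‖u y‖ * (c * ‖y - x‖⁻¹ ^ 2 * ‖u x‖ + c * ‖y - x‖⁻¹ * ‖fderiv ℝ u x‖) := by gcongr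
      _ = _ := by ring
  · have hwz : w z = 0 := by
      by_contra hne
      have := hsupp (Function.mem_support.2 hne)
      rw [mem_closedBall_zero_iff, hnz] at this
      exact hin (le_of_mul_le_mul_left this hNpos)
    have hdw : fderiv ℝ w z = 0 :=
      IsLocalMin.fderiv_eq_zero (Eventually.of_forall fun t => by rw [hwz]; exact hw0 t)
    rw [hwz, hdw] at hmain
    have : fderiv ℝ (fun z => pairKernel N w u u y z) x = 0 := by simpa using hmain
    rw [this, ← ofReal_norm]
    simp

theorem enorm_kineticKernel_le (N : ℕ) (w : R3 → ℝ) (u : R3 → ℂ) (y₁ y₂ : R3) :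
    ‖kineticKernel N w u y₁ y₂‖ₑ ≤ ∫⁻ x, 3 * (‖fderiv ℝ (fun z => pairKernel N w u u y₁ z) x‖ₑ *
      ‖fderiv ℝ (fun z => pairKernel N w u u y₂ z) x‖ₑ) := by
  refine (enorm_integral_le_lintegral_enorm _).trans (lintegral_mono fun x => ?_)
  have hg : ∀ y i, ‖gradSecond N w u y x i‖ₑ ≤ ‖fderiv ℝ (fun z => pairKernel N w u u y z) x‖ₑ :=
    fun y i => by
      refine (ContinuousLinearMap.le_opENorm _ _).trans (le_of_eq ?_)
      have : ‖e3 i‖ₑ = 1 := by rw [← ofReal_norm]; simp [e3]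
      rw [this, mul_one]
  calc _ ≤ ∑ i : Fin 3, ‖gradSecond N w u y₁ x i * (starRingEnd ℂ) (gradSecond N w u y₂ x i)‖ₑ :=
        enorm_sum_le _ _
    _ ≤ ∑ _i : Fin 3, ‖fderiv ℝ (fun z => pairKernel N w u u y₁ z) x‖ₑ *
        ‖fderiv ℝ (fun z => pairKernel N w u u y₂ z) x‖ₑ := by
        refine Finset.sum_le_sum fun i _ => ?_
        rw [enorm_mul, RCLike.enorm_conj]
        gcongr <;> exact hg _ _
    _ = _ := by simp

/-- **Hilbert–Schmidt bound on the kinetic pairing kernel.** -/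
theorem kinetic_pairing_kernel_HS_bound (ℓ b C₀ : ℝ)
    (hℓ : 0 < ℓ) (hb : 0 < b) (hC₀ : 0 < C₀) :
    ∃ C > (0 : ℝ),
    ∀ (N : ℕ) (w : R3 → ℝ) (u : R3 → ℂ) (Mu K : ℝ),
      (∀ x, 0 ≤ w x ∧ w x ≤ 1) →
      Function.support w ⊆ closedBall (0 : R3) (N * ℓ) →
      (∀ x : R3, x ≠ 0 → w x ≤ C₀ * b / ‖x‖) →
      (∀ x : R3, x ≠ 0 → DifferentiableAt ℝ w x ∧ ‖fderiv ℝ w x‖ ≤ C₀ * b / ‖x‖ ^ 2) →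
      Differentiable ℝ u →
      -- `‖u‖_{H¹} ≤ K` and `‖u‖_{L^∞} ≤ Mu`
      W1Norm 2 u ≤ ENNReal.ofReal K →
      (∀ x, ‖u x‖ ≤ Mu) →
      0 ≤ Mu → 0 ≤ K →
      -- conclusion: `‖g‖_{HS} ≤ C ‖u‖_{L^∞}² ‖u‖_{H¹}²`
      eLpNorm (fun z : R3 × R3 => kineticKernel N w u z.1 z.2) 2 volume
        ≤ ENNReal.ofReal (C * Mu ^ 2 * K ^ 2) := by
  obtain ⟨C, hCt, hC⟩ := exists_lintegral_inv_norm_sq_mul_inv_norm_sq_le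
  set I := ∫⁻ z in closedBall (0 : R3) ℓ, ‖z‖ₑ⁻¹ ^ 2 with hI
  have hIt : I ≠ ∞ := lintegral_inv_norm_sq_closedBall_ne_top ℓ
  set A : ℝ≥0∞ := 4 * (C ^ 2 * 36 + 2 * 36 * I ^ 2 + I ^ 2) with hA
  have hAt : A ≠ ∞ := by
    simp [hA, ENNReal.mul_eq_top, hCt, hIt]
  set c : ℝ≥0∞ := ENNReal.ofReal (C₀ * b) with hc
  set B : ℝ≥0∞ := 3 * c ^ 2 * A ^ (1 / 2 : ℝ) with hB
  have hBt : B ≠ ∞ := ENNReal.mul_ne_top (by simp [ENNReal.mul_eq_top, hc])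
    (ENNReal.rpow_ne_top_of_nonneg (by norm_num) hAt)
  refine ⟨B.toReal + 1, by positivity, ?_⟩
  intro N w u Mu K hw01 hsupp hw1 hw2 hu hK hMu hMu0 hK0
  set M := ENNReal.ofReal Mu with hM
  set k := ENNReal.ofReal K with hk
  have hL2 : ∀ {F : Type} [NormedAddCommGroup F] (f : R3 → F), eLpNorm f 2 volume ≤ k →
      ∫⁻ x, ‖f x‖ₑ ^ 2 ≤ k ^ 2 := fun f hf => by
    have := eLpNorm_nnreal_pow_eq_lintegral (μ := (volume : Measure R3)) (f := f)
      (p := 2) (by norm_num)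
    norm_num at this
    rw [← this]
    gcongr
  have hu2 : ∫⁻ x, ‖u x‖ₑ ^ 2 ≤ k ^ 2 := hL2 _ (le_self_add.trans hK)
  have hdu2 : ∫⁻ x, ‖fderiv ℝ u x‖ₑ ^ 2 ≤ k ^ 2 := hL2 _ (le_add_self.trans hK)
  have huM : ∀ x, ‖u x‖ₑ ≤ M := fun x => by
    rw [← ofReal_norm]; exact ENNReal.ofReal_le_ofReal (hMu x)
  have hardy : ∀ y : R3, ∫⁻ x, ‖y - x‖ₑ⁻¹ ^ 2 * ‖u x‖ₑ ^ 2 ≤ 36 * k ^ 2 := fun y => by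
    have hv := lintegral_enorm_sq_mul_inv_norm_sq_le (v := fun x => u (x + y)) (by fun_prop)
      (M := M) ENNReal.ofReal_ne_top (fun x => huM _) (by
        rw [lintegral_add_right_eq_self fun x => ‖u x‖ₑ ^ 2]
        exact (hu2.trans_lt (by simp [hk])).ne)
    simp only [fderiv_comp_add_right] at hv
    rw [lintegral_add_right_eq_self fun x => ‖fderiv ℝ u x‖ₑ ^ 2] at hv
    rw [← lintegral_add_right_eq_self _ y]
    calc _ = ∫⁻ x, ‖u (x + y)‖ₑ ^ 2 * ‖x‖ₑ⁻¹ ^ 2 := lintegral_congr fun x => by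
          rw [sub_add_cancel_right, enorm_neg, mul_comm]
      _ ≤ _ := hv.trans (by gcongr)
  set F : R3 → R3 → ℝ≥0∞ := fun y x => ‖u y‖ₑ *
    (cutInvNorm ℓ (y - x) ^ 2 * ‖u x‖ₑ + cutInvNorm ℓ (y - x) * ‖fderiv ℝ u x‖ₑ)
  have hum : Measurable fun x => ‖u x‖ₑ := hu.continuous.measurable.enorm
  have hdm : Measurable fun x => ‖fderiv ℝ u x‖ₑ := (measurable_fderiv ℝ u).enorm
  have hcm := measurable_cutInvNorm ℓ
  have hFm : ∀ y, Measurable (F y) := fun y => by fun_prop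
  have hcore : ∫⁻ z : R3 × R3, (∫⁻ x, F z.1 x * F z.2 x) ^ 2 ≤ A * M ^ 4 * k ^ 4 :=
    lintegral_prod_mul_sq_le hum hdm hcm huM hu2 hdu2 (cutInvNorm_le ℓ)
      (lintegral_cutInvNorm_sq ℓ).le hC hardy
  have hker : ∀ z : R3 × R3, ‖kineticKernel N w u z.1 z.2‖ₑ ≤
      3 * c ^ 2 * ∫⁻ x, F z.1 x * F z.2 x := fun z => by
    refine (enorm_kineticKernel_le N w u z.1 z.2).trans ?_
    rw [← lintegral_const_mul _ (by fun_prop)]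
    refine lintegral_mono_ae ?_
    filter_upwards [Measure.ae_ne volume z.1, Measure.ae_ne volume z.2] with x h1 h2
    have hb : ∀ y, x ≠ y → ‖fderiv ℝ (fun z => pairKernel N w u u y z) x‖ₑ ≤ c * F y x :=
      fun y hy => enorm_fderiv_pairKernel_le (by positivity) (fun x => (hw01 x).1) hsupp hw1 hw2
        hu hy
    calc _ ≤ 3 * ((c * F z.1 x) * (c * F z.2 x)) := by
          gcongr
          exacts [hb _ h1, hb _ h2]
      _ = _ := by ring
  have hsq : ∀ a : ℝ≥0∞, (a ^ 2) ^ (1 / 2 : ℝ) = a := fun a => by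
    rw [← ENNReal.rpow_two, ← ENNReal.rpow_mul]; norm_num
  have hbound : ∫⁻ z : R3 × R3, ‖kineticKernel N w u z.1 z.2‖ₑ ^ 2 ≤
      (3 * c ^ 2 * M ^ 2 * k ^ 2) ^ 2 * A := by
    calc _ ≤ ∫⁻ z : R3 × R3, (3 * c ^ 2) ^ 2 * (∫⁻ x, F z.1 x * F z.2 x) ^ 2 :=
          lintegral_mono fun z => by
            rw [← mul_pow]; gcongr; exact hker z
      _ = (3 * c ^ 2) ^ 2 * ∫⁻ z : R3 × R3, (∫⁻ x, F z.1 x * F z.2 x) ^ 2 :=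
          lintegral_const_mul' _ _ (by simp [ENNReal.mul_eq_top, hc])
      _ ≤ (3 * c ^ 2) ^ 2 * (A * M ^ 4 * k ^ 4) := by gcongr
      _ = _ := by ring
  rw [eLpNorm_eq_lintegral_rpow_enorm_toReal (by simp) (by simp)]
  simp only [ENNReal.toReal_ofNat, ENNReal.rpow_two]
  calc _ ≤ ((3 * c ^ 2 * M ^ 2 * k ^ 2) ^ 2 * A) ^ (1 / 2 : ℝ) := by gcongr
    _ = B * M ^ 2 * k ^ 2 := by
        rw [ENNReal.mul_rpow_of_nonneg _ _ (by norm_num), hsq, hB]; ring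
    _ ≤ ENNReal.ofReal (B.toReal + 1) * M ^ 2 * k ^ 2 := by
        gcongr
        rw [← ENNReal.ofReal_toReal hBt]
        refine ENNReal.ofReal_le_ofReal ?_
        rw [ENNReal.toReal_ofReal ENNReal.toReal_nonneg]
        linarith
    _ = _ := by
        rw [ENNReal.ofReal_mul (by positivity), ENNReal.ofReal_mul (by positivity),
          ENNReal.ofReal_pow hMu0, ENNReal.ofReal_pow hK0]
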